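/- arXiv:2503.03949 — 2 statements merged into one kernel-verified Lean document; each statement's English description precedes it below -/
import Mathlib

section
/- For all pairs (i, j) and (p, q) with i ≠ j and p ≠ q, one has ⟨ω_{îj}, ω_{p̂q}⟩ > 0, where ω_{îj} := (b_{ij}/2)·α_i + α_j and b_{ij} := −2B_{ij}. -/
open Matrix

/-- The bilinear form `⟨x, y⟩ = -xᵀ B⁻¹ y` on `ℝ^l`. -/
noncomputable def bilB {l : ℕ} (B : Matrix (Fin l) (Fin l) ℝ) (x y : Fin l → ℝ) : ℝ :=
  -(x ⬝ᵥ B⁻¹.mulVec y)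

/-- `α j := -B·e j`, the `j`-th column of `-B`. -/
def alphaVec {l : ℕ} (B : Matrix (Fin l) (Fin l) ℝ) (j : Fin l) : Fin l → ℝ :=
  fun p => -B p j

/-- `ω_{îj} := (b i j / 2) • α i + α j`, where `b i j = -2 B i j`. -/
noncomputable def omegaVec {l : ℕ} (B : Matrix (Fin l) (Fin l) ℝ) (i j : Fin l) :
    Fin l → ℝ :=
  ((-2 * B i j) / 2) • alphaVec B i + alphaVec B j

/-- The Gram matrix of the columns of `-B` for `bilB B` is `-B`. -/
theorem bilB_alphaVec {l : ℕ} {B : Matrix (Fin l) (Fin l) ℝ} (hsymm : B.IsSymm)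
    (hunit : IsUnit B.det) (i j : Fin l) :
    bilB B (alphaVec B i) (alphaVec B j) = -B i j := by
  have hcol : alphaVec B j = -(B *ᵥ Pi.single j 1) := by
    ext p
    simp [alphaVec]
  have hinv : B⁻¹ *ᵥ alphaVec B j = -Pi.single j 1 := by
    rw [hcol, mulVec_neg, mulVec_mulVec, nonsing_inv_mul _ hunit, one_mulVec]
  rw [bilB, hinv]
  simp [alphaVec, hsymm.apply i j]

theorem bilB_smul_add_smul_add {l : ℕ} (B : Matrix (Fin l) (Fin l) ℝ) (c d : ℝ)
    (x y z w : Fin l → ℝ) :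
    bilB B (c • x + y) (d • z + w) =
      c * d * bilB B x z + c * bilB B x w + d * bilB B y z + bilB B y w := by
  simp only [bilB, mulVec_add, mulVec_smul, add_dotProduct, dotProduct_add, smul_dotProduct,
    dotProduct_smul, smul_eq_mul]
  ring

theorem bilB_omegaVec {l : ℕ} {B : Matrix (Fin l) (Fin l) ℝ} (hsymm : B.IsSymm)
    (hunit : IsUnit B.det) (i j p q : Fin l) :
    bilB B (omegaVec B i j) (omegaVec B p q) =
      -(B i j * B p q * B i p) + B i j * B i q + B p q * B j p - B j q := by
  simp only [omegaVec, bilB_smul_add_smul_add, bilB_alphaVec hsymm hunit]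
  ring

/-- Positivity for any symmetric matrix with unit diagonal and off-diagonal entries below `-1`. -/
theorem bilB_omegaVec_pos {l : ℕ} {B : Matrix (Fin l) (Fin l) ℝ} (hsymm : B.IsSymm)
    (hunit : IsUnit B.det) (hdiag : ∀ i, B i i = 1) (hoff : ∀ i j, i ≠ j → B i j < -1)
    {i j p q : Fin l} (hij : i ≠ j) (hpq : p ≠ q) :
    0 < bilB B (omegaVec B i j) (omegaVec B p q) := by
  rw [bilB_omegaVec hsymm hunit]
  obtain ⟨A, rfl⟩ : ∃ A : Matrix (Fin l) (Fin l) ℝ, B = -A := ⟨-B, (neg_neg B).symm⟩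
  have hA : ∀ a b, A a b = A b a := fun a b => by simpa using hsymm.apply b a
  have hd : ∀ a, A a a = -1 := fun a => by
    have := hdiag a
    simp only [Matrix.neg_apply] at this
    linarith
  have ho : ∀ a b, a ≠ b → 1 < A a b := fun a b h => by
    have := hoff a b h
    simp only [Matrix.neg_apply] at this
    linarith
  simp only [Matrix.neg_apply]
  have hc := ho i j hij
  have hm := ho p q hpq
  have hc2 : 1 < A i j * A i j := one_lt_mul_of_lt_of_le hc hc.le
  have hm2 : 1 < A p q * A p q := one_lt_mul_of_lt_of_le hm hm.le
  have hcm : 1 < A i j * A p q := one_lt_mul_of_lt_of_le hc hm.le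
  by_cases hip : i = p
  · subst hip
    by_cases hjq : j = q
    · subst hjq
      rw [hd i, hd j, hA j i]
      linarith
    · have := ho j q hjq
      rw [hd i, hA j i]
      linarith
  · have h1 := ho i p hip
    have h1' : 1 < A i j * A p q * A i p := one_lt_mul_of_lt_of_le hcm h1.le
    by_cases hjq : j = q
    · subst hjq
      rw [hd j, hA j p]
      linarith
    · have h2 := ho j q hjq
      by_cases hiq : i = q
      · subst hiq
        by_cases hjp : j = p
        · subst hjp
          rw [hA j i, hd i, hd j]
          nlinarith
        · have h3 := ho j p hjp
          rw [hA p i, hd i, hA j i]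
          have : 0 < A i j * A i p * A i p := by positivity
          have : 0 < A i p * A j p := by positivity
          linarith
      · have h4 := ho i q hiq
        by_cases hjp : j = p
        · subst hjp
          rw [hd j]
          nlinarith
        · have h3 := ho j p hjp
          have : 0 < A i j * A i q := by positivity
          have : 0 < A p q * A j p := by positivity
          linarith

/-- `⟨ω_{îj}, ω_{p̂q}⟩ > 0` for all pairs `i ≠ j` and `p ≠ q`. -/
theorem omega_pairing_pos
    (n k : ℕ) (hn : 2 ≤ n) (hk : 1 ≤ k)
    (α : Fin k → ℕ) (hα : ∀ i, 0 < α i)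
    (l : ℕ) (hl : l = ∑ i, α i) (hl2 : 2 ≤ l) (hexc : ¬(n = 2 ∧ l = 2))
    (blk : Fin l → Fin k) (hmono : Monotone blk)
    (hcard : ∀ j, (Finset.univ.filter fun i => blk i = j).card = α j)
    (B : Matrix (Fin l) (Fin l) ℝ)
    (hB : ∀ i j, B i j =
      if i = j then 1 else if blk i = blk j then -(n : ℝ) else -((n : ℝ) + 1 / 2))
    (hunit : IsUnit B.det) :
    ∀ i j p q : Fin l, i ≠ j → p ≠ q →
      0 < bilB B (omegaVec B i j) (omegaVec B p q) := by
  have hn' : (2 : ℝ) ≤ n := by exact_mod_cast hn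
  have hsymm : B.IsSymm := by
    ext i j
    simp only [transpose_apply, hB, eq_comm]
  refine fun i j p q => bilB_omegaVec_pos hsymm hunit (fun i => by simp [hB]) fun i j hij => ?_
  rw [hB, if_neg hij]
  split_ifs <;> linarith
end

section
/- T̄ ∩ {v ∈ ℝ^l : ⟨v, e_l⟩ ≤ 0} equals the convex hull of the set (ℝ_{≥0}·e_l) ∪ (T̄ ∩ {v : ⟨v, e_l⟩ = 0}). -/
open Matrix

/-- The Tits cone `T = ⋃_{w ∈ W} w(Ā)`, where `Ā` is the cone of nonnegative
coordinate vectors and `W` is the group generated by the involutions `M j`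
(every element of `W` is a product of the generators, i.e. a word). -/
def titsCone {l : ℕ} (M : Fin l → Matrix (Fin l) (Fin l) ℝ) : Set (Fin l → ℝ) :=
  {x | ∃ (L : List (Fin l)) (a : Fin l → ℝ),
    (∀ i, 0 ≤ a i) ∧ x = (L.map M).prod.mulVec a}

/-- `M` is a family of reflections `x ↦ x - 2 x_j B e_j`, for a symmetric matrix `B` with ones on
the diagonal and off-diagonal entries at most `-1`. -/
structure IsReflectionFamily {l : ℕ} (B : Matrix (Fin l) (Fin l) ℝ)
    (M : Fin l → Matrix (Fin l) (Fin l) ℝ) : Prop where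
  diag : ∀ i, B i i = 1
  offDiag : ∀ i j, i ≠ j → B i j ≤ -1
  symm : ∀ i j, B i j = B j i
  mulVec_apply : ∀ j x i, (M j *ᵥ x) i = x i - 2 * B i j * x j

namespace IsReflectionFamily

variable {l : ℕ} {B : Matrix (Fin l) (Fin l) ℝ} {M : Fin l → Matrix (Fin l) (Fin l) ℝ}

theorem mulVec_apply_self (h : IsReflectionFamily B M) (j : Fin l) (x : Fin l → ℝ) :
    (M j *ᵥ x) j = -x j := by
  rw [h.mulVec_apply, h.diag]; ring

theorem le_mulVec_apply (h : IsReflectionFamily B M) {i j : Fin l} (hij : i ≠ j) {x : Fin l → ℝ}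
    (hx : 0 ≤ x j) : x i + 2 * x j ≤ (M j *ᵥ x) i := by
  rw [h.mulVec_apply]
  nlinarith [h.offDiag i j hij]

theorem mulVec_eq_self (h : IsReflectionFamily B M) {j : Fin l} {x : Fin l → ℝ} (hx : x j = 0) :
    M j *ᵥ x = x := by
  ext i
  rw [h.mulVec_apply, hx]; ring

theorem mulVec_mulVec_self (h : IsReflectionFamily B M) (j : Fin l) (x : Fin l → ℝ) :
    M j *ᵥ (M j *ᵥ x) = x := by
  ext i
  rw [h.mulVec_apply, h.mulVec_apply_self, h.mulVec_apply]; ring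

/-- Ping-pong estimate: after a reduced word, only the coordinate of the first letter can be
negative, and every other coordinate dominates its absolute value. -/
theorem reduced_coordinates (h : IsReflectionFamily B M) {a : Fin l → ℝ} (ha : ∀ i, 0 ≤ a i)
    {L : List (Fin l)} (hL : L.IsChain (· ≠ ·)) {j : Fin l} (hj : j ∉ L.head?) :
    0 ≤ ((L.map M).prod *ᵥ a) j ∧
      ∀ i, -((L.map M).prod *ᵥ a) i ≤ ((L.map M).prod *ᵥ a) j := by
  induction L generalizing j with
  | nil =>
    simp only [List.map_nil, List.prod_nil, one_mulVec]
    exact ⟨ha j, fun i => by linarith [ha i, ha j]⟩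
  | cons m L ih =>
    rw [List.isChain_cons] at hL
    obtain ⟨hz, hzi⟩ := ih hL.2 (j := m) fun hm => hL.1 m hm rfl
    simp only [List.map_cons, List.prod_cons, ← mulVec_mulVec]
    set z := (L.map M).prod *ᵥ a
    have key : ∀ i, i ≠ m → z m ≤ (M m *ᵥ z) i := fun i hi => by
      linarith [h.le_mulVec_apply hi hz, hzi i]
    have hjm : j ≠ m := by
      rintro rfl; simp at hj
    refine ⟨hz.trans (key j hjm), fun i => ?_⟩
    by_cases hi : i = m
    · rw [hi, h.mulVec_apply_self, neg_neg]
      exact key j hjm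
    · linarith [key i hi, key j hjm]

theorem exists_reduced (h : IsReflectionFamily B M) {x : Fin l → ℝ} (hx : x ∈ titsCone M) :
    ∃ (L : List (Fin l)) (a : Fin l → ℝ),
      L.IsChain (· ≠ ·) ∧ (∀ i, 0 ≤ a i) ∧ x = (L.map M).prod *ᵥ a := by
  obtain ⟨L, a, ha, rfl⟩ := hx
  suffices ∃ L' : List (Fin l), L'.IsChain (· ≠ ·) ∧
      (L.map M).prod *ᵥ a = (L'.map M).prod *ᵥ a by
    obtain ⟨L', hL', he⟩ := this
    exact ⟨L', a, hL', ha, he⟩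
  induction L with
  | nil => exact ⟨[], List.isChain_nil, rfl⟩
  | cons m L ih =>
    obtain ⟨L', hL', he⟩ := ih
    simp only [List.map_cons, List.prod_cons, ← mulVec_mulVec, he]
    by_cases hm : m ∈ L'.head?
    · cases L' with
      | nil => simp at hm
      | cons p L'' =>
        obtain rfl : p = m := by simpa using hm
        refine ⟨L'', (List.isChain_cons.1 hL').2, ?_⟩
        simp only [List.map_cons, List.prod_cons, ← mulVec_mulVec, h.mulVec_mulVec_self]
    · refine ⟨m :: L', List.isChain_cons.2 ⟨fun y hy hmy => hm (hmy ▸ hy), hL'⟩, ?_⟩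
      simp only [List.map_cons, List.prod_cons, ← mulVec_mulVec]

end IsReflectionFamily

section TitsCone

variable {l : ℕ} {B : Matrix (Fin l) (Fin l) ℝ} {M : Fin l → Matrix (Fin l) (Fin l) ℝ}

theorem mem_titsCone_of_nonneg {a : Fin l → ℝ} (ha : ∀ i, 0 ≤ a i) : a ∈ titsCone M :=
  ⟨[], a, ha, by simp⟩

theorem mulVec_mem_titsCone (j : Fin l) {x : Fin l → ℝ} (hx : x ∈ titsCone M) :
    M j *ᵥ x ∈ titsCone M := by
  obtain ⟨L, a, ha, rfl⟩ := hx
  exact ⟨j :: L, a, ha, by simp⟩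

theorem smul_mem_titsCone {c : ℝ} (hc : 0 ≤ c) {x : Fin l → ℝ} (hx : x ∈ titsCone M) :
    c • x ∈ titsCone M := by
  obtain ⟨L, a, ha, rfl⟩ := hx
  exact ⟨L, c • a, fun i => mul_nonneg hc (ha i), (mulVec_smul _ _ _).symm⟩

theorem IsReflectionFamily.nonneg_add_mem_titsCone (h : IsReflectionFamily B M)
    {L : List (Fin l)} (hL : L.IsChain (· ≠ ·)) {a x : Fin l → ℝ} (ha : ∀ i, 0 ≤ a i)
    (hx : ∀ i, 0 ≤ x i) : x + (L.map M).prod *ᵥ a ∈ titsCone M := by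
  induction L generalizing a x with
  | nil => exact mem_titsCone_of_nonneg fun i => by simpa using add_nonneg (hx i) (ha i)
  | cons j L ih =>
    have hcoord : ∀ i, i ≠ j → 0 ≤ (((j :: L).map M).prod *ᵥ a) i := fun i hi =>
      (h.reduced_coordinates ha hL (by simpa using hi.symm)).1
    have hrefl : M j *ᵥ (((j :: L).map M).prod *ᵥ a) = (L.map M).prod *ᵥ a := by
      simp only [List.map_cons, List.prod_cons, ← mulVec_mulVec, h.mulVec_mulVec_self]
    set y := ((j :: L).map M).prod *ᵥ a
    by_cases hp : 0 ≤ x j + y j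
    · refine mem_titsCone_of_nonneg fun i => ?_
      by_cases hi : i = j
      · rw [hi]; exact hp
      · exact add_nonneg (hx i) (hcoord i hi)
    · push Not at hp
      have hy : 0 < -y j := by linarith [hx j]
      set t := x j / -y j with ht
      have ht0 : 0 ≤ t := div_nonneg (hx j) hy.le
      have ht1 : t ≤ 1 := by rw [ht, div_le_one hy]; linarith
      have hzj : (x + t • y) j = 0 := by
        simp only [Pi.add_apply, Pi.smul_apply, smul_eq_mul, ht]
        field_simp [hy.ne', (neg_pos.1 hy).ne]
        ring
      have hz : ∀ i, 0 ≤ (x + t • y) i := fun i => by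
        by_cases hi : i = j
        · rw [hi, hzj]
        · exact add_nonneg (hx i) (mul_nonneg ht0 (hcoord i hi))
      have hmem := mulVec_mem_titsCone j (ih (List.isChain_cons.1 hL).2
        (a := (1 - t) • a) (fun i => mul_nonneg (sub_nonneg.2 ht1) (ha i)) hz)
      convert hmem using 1
      rw [mulVec_add, h.mulVec_eq_self hzj, mulVec_smul, mulVec_smul, ← hrefl,
        h.mulVec_mulVec_self]
      module

theorem IsReflectionFamily.add_mem_titsCone (h : IsReflectionFamily B M) {x y : Fin l → ℝ}
    (hx : x ∈ titsCone M) (hy : y ∈ titsCone M) : x + y ∈ titsCone M := by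
  obtain ⟨L, a, ha, rfl⟩ := hx
  induction L generalizing y with
  | nil =>
    obtain ⟨L', a', hL', ha', rfl⟩ := h.exists_reduced hy
    simpa using h.nonneg_add_mem_titsCone hL' ha' ha
  | cons j L ih =>
    have := mulVec_mem_titsCone j (ih (mulVec_mem_titsCone j hy))
    rw [mulVec_add, h.mulVec_mulVec_self, mulVec_mulVec] at this
    simpa using this

theorem IsReflectionFamily.convex_titsCone (h : IsReflectionFamily B M) :
    Convex ℝ (titsCone M) := fun _ hx _ hy _ _ hs ht _ =>
  h.add_mem_titsCone (smul_mem_titsCone hs hx) (smul_mem_titsCone ht hy)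

theorem smul_mem_closure_titsCone {c : ℝ} (hc : 0 ≤ c) {x : Fin l → ℝ}
    (hx : x ∈ closure (titsCone M)) : c • x ∈ closure (titsCone M) :=
  map_mem_closure (continuous_const_smul c) hx fun _ hy => smul_mem_titsCone hc hy

/-- The form `x ↦ x ⬝ᵥ c`, where `B c = e_p`, only changes under the reflection `M p`. -/
theorem IsReflectionFamily.mulVec_dotProduct (h : IsReflectionFamily B M) {c : Fin l → ℝ}
    {p : Fin l} (hc : B *ᵥ c = Pi.single p 1) (j : Fin l) (x : Fin l → ℝ) :
    (M j *ᵥ x) ⬝ᵥ c = x ⬝ᵥ c - if j = p then 2 * x j else 0 := by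
  have hj : ∑ i, B j i * c i = if j = p then 1 else 0 := by
    have := congrFun hc j
    simpa [mulVec, dotProduct, Pi.single_apply] using this
  calc (M j *ᵥ x) ⬝ᵥ c = x ⬝ᵥ c - 2 * x j * ∑ i, B j i * c i := by
        simp only [dotProduct, h.mulVec_apply, Finset.mul_sum, ← Finset.sum_sub_distrib]
        refine Finset.sum_congr rfl fun i _ => ?_
        rw [h.symm j i]; ring
    _ = _ := by rw [hj]; split_ifs <;> ring

/-- The points of the Tits cone on the side of `e_p` of the hyperplane `x ⬝ᵥ c = 0` project, along
`e_p`, to points of the Tits cone in this hyperplane. -/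
theorem IsReflectionFamily.proj_mem_titsCone (h : IsReflectionFamily B M) {c : Fin l → ℝ}
    {p : Fin l} (hc : B *ᵥ c = Pi.single p 1) (hp0 : 0 < c p) (hp2 : c p ≤ 2)
    (hneg : ∀ i, i ≠ p → c i ≤ 0) {x : Fin l → ℝ} (hx : x ∈ titsCone M) (hxc : 0 < x ⬝ᵥ c) :
    x - (x ⬝ᵥ c / c p) • Pi.single p 1 ∈ titsCone M := by
  obtain ⟨L, a, hL, ha, rfl⟩ := h.exists_reduced hx
  suffices (L.map M).prod *ᵥ a ⬝ᵥ c ≤ 0 ∨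
      ((L.map M).prod *ᵥ a ⬝ᵥ c ≤ 2 * ((L.map M).prod *ᵥ a) p ∧
        (L.map M).prod *ᵥ a - ((L.map M).prod *ᵥ a ⬝ᵥ c / c p) • Pi.single p 1 ∈ titsCone M) from
    (this.resolve_left hxc.not_ge).2
  clear hx hxc
  induction L with
  | nil =>
    simp only [List.map_nil, List.prod_nil, one_mulVec]
    have hle : a ⬝ᵥ c ≤ a p * c p := by
      rw [dotProduct, ← Finset.add_sum_erase _ _ (Finset.mem_univ p)]
      have : ∑ i ∈ Finset.univ.erase p, a i * c i ≤ 0 := Finset.sum_nonpos fun i hi =>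
        mul_nonpos_of_nonneg_of_nonpos (ha i) (hneg i (Finset.ne_of_mem_erase hi))
      linarith
    refine Or.inr ⟨by nlinarith [ha p], mem_titsCone_of_nonneg fun i => ?_⟩
    by_cases hi : i = p
    · subst hi
      simpa using (div_le_iff₀ hp0).2 hle
    · simpa [Pi.single_apply, hi] using ha i
  | cons j L ih =>
    rw [List.isChain_cons] at hL
    have hz := (h.reduced_coordinates ha hL.2 (j := j) fun hm => hL.1 j hm rfl).1
    have ih := ih hL.2
    simp only [List.map_cons, List.prod_cons, ← mulVec_mulVec]
    set z := (L.map M).prod *ᵥ a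
    rw [h.mulVec_dotProduct hc]
    by_cases hj : j = p
    · subst hj
      left
      rw [if_pos rfl]
      rcases ih with ih | ih <;> linarith [ih]
    · rw [if_neg hj, sub_zero]
      refine ih.imp_right fun ⟨h1, h2⟩ => ⟨?_, ?_⟩
      · linarith [h.le_mulVec_apply (Ne.symm hj) hz]
      · have h3 := mulVec_mem_titsCone j h2
        rwa [mulVec_sub, mulVec_smul, h.mulVec_eq_self (x := Pi.single p 1)
          (by simp [hj])] at h3

/-- The half of the closed Tits cone on the side of `e_p` is the join of the ray of `e_p` and the
slice of the closed Tits cone by the boundary hyperplane. -/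
theorem IsReflectionFamily.closure_titsCone_inter_halfspace (h : IsReflectionFamily B M)
    {c : Fin l → ℝ} {p : Fin l} (hc : B *ᵥ c = Pi.single p 1) (hp0 : 0 < c p) (hp2 : c p ≤ 2)
    (hneg : ∀ i, i ≠ p → c i ≤ 0) :
    closure (titsCone M) ∩ {v | 0 ≤ v ⬝ᵥ c} =
      convexHull ℝ ({x | ∃ t : ℝ, 0 ≤ t ∧ x = t • Pi.single p 1} ∪
        (closure (titsCone M) ∩ {v | v ⬝ᵥ c = 0})) := by
  have hsc : (Pi.single p 1 : Fin l → ℝ) ⬝ᵥ c = c p := by simp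
  have hcont : Continuous fun v : Fin l → ℝ => v ⬝ᵥ c := by
    unfold dotProduct
    fun_prop
  apply Set.Subset.antisymm
  · rintro v ⟨hv, hvc⟩
    rcases (show 0 ≤ v ⬝ᵥ c from hvc).eq_or_lt with h0 | hpos
    · exact subset_convexHull ℝ _ (Or.inr ⟨hv, h0.symm⟩)
    have hproj : v - (v ⬝ᵥ c / c p) • Pi.single p 1 ∈ closure (titsCone M) := by
      have hv' : v ∈ closure ({v | 0 < v ⬝ᵥ c} ∩ titsCone M) :=
        (isOpen_lt continuous_const hcont).inter_closure ⟨hpos, hv⟩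
      refine map_mem_closure (f := fun v => v - (v ⬝ᵥ c / c p) • Pi.single p 1) ?_ hv'
        fun y hy => h.proj_mem_titsCone hc hp0 hp2 hneg hy.2 hy.1
      exact continuous_id.sub ((hcont.div_const _).smul continuous_const)
    have hslice : (2 : ℝ) • (v - (v ⬝ᵥ c / c p) • Pi.single p 1) ∈
        closure (titsCone M) ∩ {v | v ⬝ᵥ c = 0} := by
      refine ⟨smul_mem_closure_titsCone zero_le_two hproj, ?_⟩
      simp only [Set.mem_ofPred_eq, smul_dotProduct, sub_dotProduct, hsc, smul_eq_mul]
      field_simp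
      ring
    have hray : (2 * (v ⬝ᵥ c / c p)) • (Pi.single p 1 : Fin l → ℝ) ∈
        {x | ∃ t : ℝ, 0 ≤ t ∧ x = t • Pi.single p 1} := ⟨_, by positivity, rfl⟩
    have hmid : v = (1 / 2 : ℝ) • (2 * (v ⬝ᵥ c / c p)) • (Pi.single p 1 : Fin l → ℝ) +
        (1 / 2 : ℝ) • (2 : ℝ) • (v - (v ⬝ᵥ c / c p) • Pi.single p 1) := by module
    rw [hmid]
    exact convex_convexHull ℝ _ (subset_convexHull ℝ _ (Set.mem_union_left _ hray))
      (subset_convexHull ℝ _ (Set.mem_union_right _ hslice)) (by norm_num) (by norm_num)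
      (by norm_num)
  · refine convexHull_min (Set.union_subset ?_ fun v hv => ⟨hv.1, hv.2.ge⟩) ?_
    · rintro _ ⟨t, ht, rfl⟩
      refine ⟨subset_closure (smul_mem_titsCone ht (mem_titsCone_of_nonneg fun i => ?_)), ?_⟩
      · rw [Pi.single_apply]; split_ifs <;> norm_num
      · simpa using mul_nonneg ht hp0.le
    · refine h.convex_titsCone.closure.inter fun x hx y hy s t hs ht _ => ?_
      simp only [Set.mem_ofPred_eq, add_dotProduct, smul_dotProduct, smul_eq_mul] at *
      positivity

end TitsCone

section BlockMatrix

variable {l k n : ℕ} {blk : Fin l → Fin k} {B : Matrix (Fin l) (Fin l) ℝ}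

theorem blockMatrix_mulVec_apply
    (hB : ∀ i j, B i j =
      if i = j then 1 else if blk i = blk j then -(n : ℝ) else -((n : ℝ) + 1 / 2))
    (c : Fin l → ℝ) (i : Fin l) :
    (B *ᵥ c) i = (1 + n) * c i + (∑ j with blk j = blk i, c j) / 2 - (n + 1 / 2) * ∑ j, c j := by
  have hterm : ∀ j, B i j * c j = (1 + n) * (if i = j then c j else 0) +
      (if blk j = blk i then c j else 0) / 2 - (n + 1 / 2) * c j := fun j => by
    rw [hB]
    by_cases hij : i = j
    · subst hij; simp; ring
    · by_cases hb : blk i = blk j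
      · simp [hij, hb]; ring
      · simp [hij, hb, Ne.symm hb]; ring
  simp only [mulVec, dotProduct, hterm, Finset.sum_sub_distrib, Finset.sum_add_distrib,
    ← Finset.mul_sum, ← Finset.sum_div, Finset.sum_filter, Finset.sum_ite_eq, Finset.mem_univ,
    if_true]

theorem blockMatrix_sum_block
    (hB : ∀ i j, B i j =
      if i = j then 1 else if blk i = blk j then -(n : ℝ) else -((n : ℝ) + 1 / 2))
    {c : Fin l → ℝ} (hc : ∀ i, 0 ≤ (B *ᵥ c) i) (b : Fin k) :
    (n + 1 / 2) * (Finset.univ.filter fun i => blk i = b).card * ∑ j, c j ≤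
      (1 + n + ((Finset.univ.filter fun i => blk i = b).card : ℝ) / 2) *
        ∑ j with blk j = b, c j := by
  have hnonneg : 0 ≤ ∑ i with blk i = b, (B *ᵥ c) i := Finset.sum_nonneg fun i _ => hc i
  have heq : ∑ i with blk i = b, (B *ᵥ c) i = ∑ i with blk i = b,
      ((1 + n) * c i + (∑ j with blk j = b, c j) / 2 - (n + 1 / 2) * ∑ j, c j) := by
    refine Finset.sum_congr rfl fun i hi => ?_
    rw [blockMatrix_mulVec_apply hB, (Finset.mem_filter.1 hi).2]
  rw [heq, Finset.sum_sub_distrib, Finset.sum_add_distrib, ← Finset.mul_sum, Finset.sum_const,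
    Finset.sum_const, nsmul_eq_mul, nsmul_eq_mul] at hnonneg
  linarith

theorem blockMatrix_sum_nonpos (hn : 2 ≤ n) (hl3 : 3 ≤ l)
    (hB : ∀ i j, B i j =
      if i = j then 1 else if blk i = blk j then -(n : ℝ) else -((n : ℝ) + 1 / 2))
    {c : Fin l → ℝ} (hc : ∀ i, 0 ≤ (B *ᵥ c) i) : ∑ j, c j ≤ 0 := by
  by_contra! hS
  have hn' : (2 : ℝ) ≤ n := by exact_mod_cast hn
  have hl' : (3 : ℝ) ≤ l := by exact_mod_cast hl3
  have hblock : ∀ b : Fin k, (n + 1 / 2) * (∑ j with blk j = b, 1) * ∑ j, c j ≤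
      (1 + n + (l : ℝ) / 2) * ∑ j with blk j = b, c j := fun b => by
    have h1 := blockMatrix_sum_block hB hc b
    have hcard : ((Finset.univ.filter fun i => blk i = b).card : ℝ) ≤ l := by
      exact_mod_cast (Finset.card_filter_le _ _).trans (by simp)
    simp only [Finset.sum_const, nsmul_eq_mul, mul_one]
    set m := ((Finset.univ.filter fun i => blk i = b).card : ℝ)
    have hm : 0 ≤ m := Nat.cast_nonneg _
    have hSb : 0 ≤ ∑ j with blk j = b, c j := by
      refine nonneg_of_mul_nonneg_right (a := 1 + n + m / 2) (le_trans ?_ h1) (by positivity)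
      positivity
    exact h1.trans (mul_le_mul_of_nonneg_right (by linarith) hSb)
  have hsum := Finset.sum_le_sum fun b (_ : b ∈ Finset.univ) => hblock b
  rw [← Finset.sum_mul, ← Finset.mul_sum, ← Finset.mul_sum,
    Finset.sum_fiberwise Finset.univ blk fun _ => (1 : ℝ), Finset.sum_fiberwise] at hsum
  have := le_of_mul_le_mul_right hsum hS
  simp at this
  nlinarith

theorem blockMatrix_solution_nonpos (hn : 2 ≤ n) (hl3 : 3 ≤ l)
    (hB : ∀ i j, B i j =
      if i = j then 1 else if blk i = blk j then -(n : ℝ) else -((n : ℝ) + 1 / 2))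
    {c : Fin l → ℝ} (hc : ∀ i, 0 ≤ (B *ᵥ c) i) {i : Fin l} (hi : (B *ᵥ c) i = 0) : c i ≤ 0 := by
  have hS := blockMatrix_sum_nonpos hn hl3 hB hc
  have hblock := blockMatrix_sum_block hB hc (blk i)
  rw [blockMatrix_mulVec_apply hB] at hi
  set m := ((Finset.univ.filter fun j => blk j = blk i).card : ℝ)
  have hm : 0 ≤ m := Nat.cast_nonneg _
  have hpos : 0 < (1 + n) * (1 + n + m / 2) := by positivity
  have hprod : (1 + (n : ℝ)) * ((n + 1 / 2) * ∑ j, c j) ≤ 0 :=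
    mul_nonpos_of_nonneg_of_nonpos (by positivity)
      (mul_nonpos_of_nonneg_of_nonpos (by positivity) hS)
  refine nonpos_of_mul_nonpos_right (a := (1 + n) * (1 + n + m / 2)) ?_ hpos
  linear_combination (1 + n + m / 2) * hi + hblock / 2 + hprod

end BlockMatrix

/-- If `B c = e_p` with `B` of size at least `3`, with unit diagonal and off-diagonal entries at
most `-2`, and `c` is nonpositive off `p`, then `0 < c_p ≤ 1`. -/
theorem solution_single_pos {l : ℕ} (hl3 : 3 ≤ l) {B : Matrix (Fin l) (Fin l) ℝ}
    (hdiag : ∀ i, B i i = 1) (hoff : ∀ i j, i ≠ j → B i j ≤ -2) {c : Fin l → ℝ} {p : Fin l}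
    (hc : B *ᵥ c = Pi.single p 1) (hneg : ∀ i, i ≠ p → c i ≤ 0) : 0 < c p ∧ c p ≤ 1 := by
  have hrow : ∀ i, ∑ j, B i j * c j = if i = p then 1 else 0 := fun i => by
    simpa [mulVec, dotProduct, Pi.single_apply] using congrFun hc i
  have hle : c p ≤ 1 := by
    have hp := hrow p
    rw [if_pos rfl, ← Finset.add_sum_erase _ _ (Finset.mem_univ p), hdiag, one_mul] at hp
    have : 0 ≤ ∑ j ∈ Finset.univ.erase p, B p j * c j := Finset.sum_nonneg fun j hj => by
      have hj := Finset.ne_of_mem_erase hj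
      nlinarith [hoff p j hj.symm, hneg j hj]
    linarith
  refine ⟨?_, hle⟩
  by_contra! hp0
  have hterm : ∀ i j, i ≠ j → c j ≤ 0 → -2 * c j ≤ B i j * c j := fun i j hij hj => by
    nlinarith [hoff i j hij]
  have hall : ∀ j, c j ≤ 0 := fun j => by
    by_cases hj : j = p
    · rwa [hj]
    · exact hneg j hj
  have hsum : ∀ i, i ≠ p → -2 * ∑ j, c j ≤ -3 * c i := fun i hi => by
    have h1 := hrow i
    rw [if_neg hi, ← Finset.add_sum_erase _ _ (Finset.mem_univ i), hdiag, one_mul] at h1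
    have h2 : ∑ j ∈ Finset.univ.erase i, -2 * c j ≤ ∑ j ∈ Finset.univ.erase i, B i j * c j :=
      Finset.sum_le_sum fun j hj => hterm i j (Finset.ne_of_mem_erase hj).symm (hall j)
    rw [← Finset.mul_sum] at h2
    have h3 := Finset.add_sum_erase Finset.univ c (Finset.mem_univ i)
    linarith
  obtain ⟨i, hi, j, hj, hij⟩ : ∃ i, i ≠ p ∧ ∃ j, j ≠ p ∧ i ≠ j := by
    have : 1 < (Finset.univ.erase p).card := by
      rw [Finset.card_erase_of_mem (Finset.mem_univ p), Finset.card_univ, Fintype.card_fin]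
      omega
    obtain ⟨i, hi, j, hj, hij⟩ := Finset.one_lt_card.1 this
    exact ⟨i, Finset.ne_of_mem_erase hi, j, Finset.ne_of_mem_erase hj, hij⟩
  have htwo : ∑ m, c m ≤ c i + c j := by
    rw [← Finset.add_sum_erase _ _ (Finset.mem_univ i), ← Finset.add_sum_erase _ _
      (Finset.mem_erase.2 ⟨hij.symm, Finset.mem_univ j⟩)]
    have := Finset.sum_nonpos fun m (_ : m ∈ (Finset.univ.erase i).erase j) => hall m
    linarith
  have hzero : ∑ m, c m = 0 :=
    le_antisymm (Finset.sum_nonpos fun m _ => hall m) (by linarith [hsum i hi, hsum j hj])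
  have hc0 : ∀ m, c m = 0 := fun m =>
    (Finset.sum_eq_zero_iff_of_nonpos fun m _ => hall m).1 hzero m (Finset.mem_univ m)
  simpa [hc0] using hrow p

/-- `T̄ ∩ {v : ⟨v, e_l⟩ ≤ 0}` is the convex hull of
`ℝ_{≥0}·e_l ∪ (T̄ ∩ {v : ⟨v, e_l⟩ = 0})`. -/
theorem titsCone_halfspace_convexHull
    (n k : ℕ) (hn : 2 ≤ n) (hk : 1 ≤ k)
    (α : Fin k → ℕ) (hα : ∀ i, 0 < α i)
    (l : ℕ) (hl : l = ∑ i, α i) (hl3 : 3 ≤ l)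
    (blk : Fin l → Fin k) (hmono : Monotone blk)
    (hcard : ∀ j, (Finset.univ.filter fun i => blk i = j).card = α j)
    (B : Matrix (Fin l) (Fin l) ℝ)
    (hB : ∀ i j, B i j =
      if i = j then 1 else if blk i = blk j then -(n : ℝ) else -((n : ℝ) + 1 / 2))
    (hunit : IsUnit B.det)
    (last : Fin l) (hlast : (last : ℕ) = l - 1)
    (el : Fin l → ℝ) (hel : el = Pi.single last 1)
    (M : Fin l → Matrix (Fin l) (Fin l) ℝ)
    (hM : ∀ j i i', M j i i' =
      if i' = j then (if i = j then -1 else -2 * B i j) else (if i = i' then 1 else 0)) :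
    closure (titsCone M) ∩ {v : Fin l → ℝ | bilB B v el ≤ 0} =
      convexHull ℝ
        ({x : Fin l → ℝ | ∃ c : ℝ, 0 ≤ c ∧ x = c • el} ∪
          (closure (titsCone M) ∩ {v : Fin l → ℝ | bilB B v el = 0})) := by
  subst hel
  have hn' : (2 : ℝ) ≤ n := by exact_mod_cast hn
  have hdiag : ∀ i, B i i = 1 := fun i => by rw [hB, if_pos rfl]
  have hoff : ∀ i j, i ≠ j → B i j ≤ -2 := fun i j hij => by
    rw [hB, if_neg hij]
    split_ifs <;> linarith
  have hfam : IsReflectionFamily B M :=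
    { diag := hdiag
      offDiag := fun i j hij => (hoff i j hij).trans (by norm_num)
      symm := fun i j => by simp only [hB, eq_comm]
      mulVec_apply := fun j x i => by
        have hterm : ∀ m, M j i m * x m =
            (if i = m then x m else 0) - (if j = m then 2 * B i j * x m else 0) := fun m => by
          rw [hM]
          by_cases hmj : m = j
          · subst hmj
            by_cases him : i = m
            · subst him; simp [hdiag]; ring
            · simp [him]
          · simp [hmj, Ne.symm hmj]
        simp [mulVec, dotProduct, hterm, Finset.sum_sub_distrib] }
  have hc : B *ᵥ (B⁻¹ *ᵥ Pi.single last 1) = Pi.single last 1 := by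
    rw [mulVec_mulVec, mul_nonsing_inv B hunit, one_mulVec]
  have hbil : ∀ v, bilB B v (Pi.single last 1) = -(v ⬝ᵥ (B⁻¹ *ᵥ Pi.single last 1)) := fun _ => rfl
  simp only [hbil, neg_nonpos, neg_eq_zero]
  set c := B⁻¹ *ᵥ Pi.single last 1
  have hnonneg : ∀ i, 0 ≤ (B *ᵥ c) i := fun i => by
    rw [hc, Pi.single_apply]
    split_ifs <;> norm_num
  have hneg : ∀ i, i ≠ last → c i ≤ 0 := fun i hi =>
    blockMatrix_solution_nonpos hn hl3 hB hnonneg (by rw [hc, Pi.single_eq_of_ne hi])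
  obtain ⟨hpos, hle⟩ := solution_single_pos hl3 hdiag hoff hc hneg
  exact hfam.closure_titsCone_inter_halfspace hc hpos (by linarith) hneg
end
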